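/- Theorem 2: For any time series A and B of length L, any window size W with 0 ≤ W ≤ L, and any integer V with 1 ≤ V ≤ L/2, LB_Enhanced^V_W(A,B) ≤ DTW²_W(A,B). -/

import Mathlib

noncomputable section

/-- Squared pointwise cost. -/
def delta (x y : ℝ) : ℝ := (x - y) ^ 2

/-- Continuity/monotonicity step of a warping path. -/
def Step (q r : ℕ × ℕ) : Prop :=
  r = (q.1 + 1, q.2) ∨ r = (q.1, q.2 + 1) ∨ r = (q.1 + 1, q.2 + 1)

/-- A `W`-warping path for series of length `L` (1-based indices). -/
def IsWarpingPath (L W : ℕ) (p : List (ℕ × ℕ)) : Prop :=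
  p.head? = some (1, 1) ∧ p.getLast? = some (L, L) ∧ List.Chain' Step p ∧
    ∀ q ∈ p, 1 ≤ q.1 ∧ q.1 ≤ L ∧ 1 ≤ q.2 ∧ q.2 ≤ L ∧ ((q.1 : ℤ) - (q.2 : ℤ)).natAbs ≤ W

/-- Cost of a warping path. -/
def pathCost (A B : ℕ → ℝ) (p : List (ℕ × ℕ)) : ℝ :=
  (p.map (fun q => delta (A q.1) (B q.2))).sum

/-- `DTW²_W(A,B)`: minimum cost over all `W`-warping paths. -/
def DTW2 (L W : ℕ) (A B : ℕ → ℝ) : ℝ :=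
  sInf (pathCost A B '' {p | IsWarpingPath L W p})

/-- Left band `ℒ^W_i`. -/
def leftBand (W i : ℕ) : Finset (ℕ × ℕ) :=
  (Finset.Icc (max 1 (i - W)) i).image (fun j => (j, i)) ∪
    (Finset.Icc (max 1 (i - W)) i).image (fun k => (i, k))

/-- Right band `ℛ^W_i`. -/
def rightBand (L W i : ℕ) : Finset (ℕ × ℕ) :=
  (Finset.Icc i (min L (i + W))).image (fun j => (j, i)) ∪
    (Finset.Icc i (min L (i + W))).image (fun k => (i, k))

/-- Vertical band `𝒱_i`. -/
def vertBand (L W i : ℕ) : Finset (ℕ × ℕ) :=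
  (Finset.Icc (max 1 (i - W)) (min L (i + W))).image (fun j => (i, j))

/-- Minimum of `δ(A_j, B_k)` over a (finite, nonempty) band of pairs `(j,k)`. -/
def bandMin (A B : ℕ → ℝ) (s : Finset (ℕ × ℕ)) : ℝ :=
  sInf ((fun q => delta (A q.1) (B q.2)) '' (s : Set (ℕ × ℕ)))

/-- Upper envelope `𝕌^B_i`. -/
def upperEnv (L W : ℕ) (B : ℕ → ℝ) (i : ℕ) : ℝ :=
  sSup (B '' Set.Icc (max 1 (i - W)) (min L (i + W)))

/-- Lower envelope `𝕃^B_i`. -/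
def lowerEnv (L W : ℕ) (B : ℕ → ℝ) (i : ℕ) : ℝ :=
  sInf (B '' Set.Icc (max 1 (i - W)) (min L (i + W)))

/-- LB_Keogh term `κ_i`. -/
def kappa (L W : ℕ) (A B : ℕ → ℝ) (i : ℕ) : ℝ :=
  if upperEnv L W B i < A i then delta (A i) (upperEnv L W B i)
  else if A i < lowerEnv L W B i then delta (A i) (lowerEnv L W B i)
  else 0

theorem delta_nonneg (x y : ℝ) : 0 ≤ delta x y := sq_nonneg _

/-- Discrete intermediate value theorem along a chain of warping steps. -/
theorem exists_mem_eq_of_isChain_step (g : ℕ × ℕ → ℕ)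
    (hg : ∀ q r, Step q r → g r ≤ g q + 1) (i : ℕ) (z : ℕ × ℕ) (hz : i ≤ g z) :
    ∀ (p : List (ℕ × ℕ)) (a : ℕ × ℕ), p.head? = some a → p.getLast? = some z →
      p.IsChain Step → g a ≤ i → ∃ q ∈ p, g q = i := by
  intro p
  induction p with
  | nil => simp
  | cons x l ih =>
    intro a ha hlast hchain hai
    obtain rfl : x = a := by simpa using ha
    rcases hai.eq_or_lt with h | h
    · exact ⟨x, by simp, h⟩
    · cases l with
      | nil =>
        obtain rfl : x = z := by simpa using hlast
        omega
      | cons y m =>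
        rw [List.isChain_cons_cons] at hchain
        obtain ⟨q, hq, hqi⟩ := ih y rfl (by simpa using hlast) hchain.2
          (by have := hg x y hchain.1; omega)
        exact ⟨q, List.mem_cons_of_mem _ hq, hqi⟩

theorem sum_toFinset_le_sum_map {α : Type*} [DecidableEq α] (f : α → ℝ) (hf : ∀ q, 0 ≤ f q)
    (p : List α) : ∑ q ∈ p.toFinset, f q ≤ (p.map f).sum := by
  rw [Finset.sum_list_map_count]
  refine Finset.sum_le_sum fun q hq => ?_
  have h : 1 ≤ p.count q := List.count_pos_iff.2 (List.mem_toFinset.1 hq)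
  simpa using nsmul_le_nsmul_left (hf q) h

/-- If each `t i` is bounded by the cost of some element labelled `i`, then the sum of the `t i`
is bounded by the cost of all elements with labels in the given range. -/
theorem sum_le_sum_filter_label {α : Type*} (s : Finset α) (f : α → ℝ) (hf : ∀ q, 0 ≤ f q)
    (g : α → ℕ) (I : Finset ℕ) (t : ℕ → ℝ)
    (h : ∀ i ∈ I, ∃ q ∈ s, g q = i ∧ t i ≤ f q) :
    ∑ i ∈ I, t i ≤ ∑ q ∈ s with g q ∈ I, f q := by
  rw [← Finset.sum_fiberwise_of_maps_to (g := g) (t := I) (fun q hq => (Finset.mem_filter.1 hq).2)]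
  refine Finset.sum_le_sum fun i hi => ?_
  obtain ⟨q, hq, rfl, hle⟩ := h i hi
  exact hle.trans (Finset.single_le_sum (f := f) (fun x _ => hf x) (by simp [hq, hi]))

theorem bandMin_le (A B : ℕ → ℝ) (s : Finset (ℕ × ℕ)) {q : ℕ × ℕ} (hq : q ∈ s) :
    bandMin A B s ≤ delta (A q.1) (B q.2) :=
  csInf_le (s.finite_toSet.image _).bddBelow ⟨q, hq, rfl⟩

theorem kappa_le (L W : ℕ) (A B : ℕ → ℝ) (i j : ℕ)
    (hj : j ∈ Set.Icc (max 1 (i - W)) (min L (i + W))) :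
    kappa L W A B i ≤ delta (A i) (B j) := by
  have hfin := (Set.finite_Icc (max 1 (i - W)) (min L (i + W))).image B
  have hU : B j ≤ upperEnv L W B i := le_csSup hfin.bddAbove ⟨j, hj, rfl⟩
  have hL : lowerEnv L W B i ≤ B j := csInf_le hfin.bddBelow ⟨j, hj, rfl⟩
  unfold kappa
  split_ifs with h₁ h₂
  · exact pow_le_pow_left₀ (by linarith) (by linarith) 2
  · unfold delta
    nlinarith
  · exact delta_nonneg _ _

theorem isWarpingPath_diagonal (L W : ℕ) (hL : 1 ≤ L) :
    IsWarpingPath L W ((List.range L).map fun i => (i + 1, i + 1)) := by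
  obtain ⟨n, rfl⟩ := Nat.exists_eq_add_of_le' hL
  refine ⟨by simp [List.range_succ_eq_map], by simp [List.range_succ], ?_, ?_⟩
  · refine List.isChain_iff_getElem.2 fun i hi => ?_
    simp [Step]
  · simp only [List.mem_map, List.mem_range]
    rintro q ⟨i, hi, rfl⟩
    simp
    omega

/-- Theorem 2: `LB_Enhanced^V_W(A,B) ≤ DTW²_W(A,B)`. -/
theorem lbEnhanced_lower_bound (L W V : ℕ) (hL : 1 ≤ L) (hW : W ≤ L)
    (hV1 : 1 ≤ V) (hV2 : 2 * V ≤ L) (A B : ℕ → ℝ) :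
    (∑ i ∈ Finset.Icc 1 V, bandMin A B (leftBand W i)) +
      (∑ i ∈ Finset.Icc (V + 1) (L - V), kappa L W A B i) +
      (∑ i ∈ Finset.Icc (L - V + 1) L, bandMin A B (rightBand L W i)) ≤
    DTW2 L W A B := by
  refine le_csInf ⟨_, _, isWarpingPath_diagonal L W hL, rfl⟩ ?_
  rintro _ ⟨p, ⟨hhead, hlast, hchain, hmem⟩, rfl⟩
  set f : ℕ × ℕ → ℝ := fun q => delta (A q.1) (B q.2) with hf
  have hf0 : ∀ q, 0 ≤ f q := fun q => delta_nonneg _ _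
  have visit (g : ℕ × ℕ → ℕ) (hg : ∀ q r, Step q r → g r ≤ g q + 1) (h₁ : g (1, 1) = 1)
      (hgL : g (L, L) = L) (i : ℕ) (hi : 1 ≤ i) (hiL : i ≤ L) : ∃ q ∈ p, g q = i :=
    exists_mem_eq_of_isChain_step g hg i (L, L) (by omega) p (1, 1) hhead hlast hchain (by omega)
  have left := sum_le_sum_filter_label p.toFinset f hf0 (fun q => max q.1 q.2) (Finset.Icc 1 V)
    (fun i => bandMin A B (leftBand W i)) (by
      intro i hi
      rw [Finset.mem_Icc] at hi
      obtain ⟨⟨a, b⟩, hq, hqi⟩ := visit (fun q => max q.1 q.2)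
        (by rintro q r (rfl | rfl | rfl) <;> dsimp only <;> omega) (by simp) (by simp) i
        (by omega) (by omega)
      refine ⟨(a, b), List.mem_toFinset.2 hq, hqi, bandMin_le A B _ ?_⟩
      have := hmem _ hq
      simp [leftBand] at *
      omega)
  have mid := sum_le_sum_filter_label p.toFinset f hf0 Prod.fst (Finset.Icc (V + 1) (L - V))
    (kappa L W A B) (by
      intro i hi
      rw [Finset.mem_Icc] at hi
      obtain ⟨⟨a, b⟩, hq, rfl⟩ := visit Prod.fst
        (by rintro q r (rfl | rfl | rfl) <;> dsimp only <;> omega) rfl rfl i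
        (by omega) (by omega)
      refine ⟨(a, b), List.mem_toFinset.2 hq, rfl, kappa_le L W A B _ _ ?_⟩
      have := hmem _ hq
      simp only [Set.mem_Icc] at *
      omega)
  have right := sum_le_sum_filter_label p.toFinset f hf0 (fun q => min q.1 q.2)
    (Finset.Icc (L - V + 1) L) (fun i => bandMin A B (rightBand L W i)) (by
      intro i hi
      rw [Finset.mem_Icc] at hi
      obtain ⟨⟨a, b⟩, hq, hqi⟩ := visit (fun q => min q.1 q.2)
        (by rintro q r (rfl | rfl | rfl) <;> dsimp only <;> omega) (by simp) (by simp) i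
        (by omega) (by omega)
      refine ⟨(a, b), List.mem_toFinset.2 hq, hqi, bandMin_le A B _ ?_⟩
      have := hmem _ hq
      simp [rightBand] at *
      omega)
  refine (add_le_add (add_le_add left mid) right).trans (le_trans ?_ (sum_toFinset_le_sum_map f hf0 p))
  rw [Finset.sum_filter, Finset.sum_filter, Finset.sum_filter, ← Finset.sum_add_distrib,
    ← Finset.sum_add_distrib]
  refine Finset.sum_le_sum fun q _ => ?_
  have := hf0 q
  simp only [Finset.mem_Icc]
  split_ifs <;> first | omega | linarith
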